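/- arXiv:1804.08466 — 2 statements merged into one kernel-verified Lean document; each statement's English description precedes it below -/
import Mathlib

section
/- Let Y carry the cylinder topology τ_cyl built from locally compact T1 sober spaces. The sets Z(U) ∩ Z(K)ᶜ, for U open in some Y_k and K a compact subset of the disjoint union ⨆_k Y_k (equivalently, a finite union of compact subsets K_i ⊆ Y_{k_i}), form a basis for the patch topology of (Y, τ_cyl). -/
open Set Topology TopologicalSpace Filter

universe u

variable {X : ℕ → Type u}

/-- Restriction (truncation) of a finite sequence of length `l` to length `k ≤ l`. -/
def restrictSeq {X : ℕ → Type u} {k l : ℕ} (h : k ≤ l) (f : (i : Fin l) → X i.1) :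
    (i : Fin k) → X i.1 :=
  fun i => f ⟨i.1, lt_of_lt_of_le i.2 h⟩

/-- The space `Y` of all finite and infinite compatible sequences for the family
of subspaces `Y k ⊆ X 0 × ⋯ × X (k-1)`. -/
def PathSpace (Y : (k : ℕ) → Set ((i : Fin k) → X i.1)) : Type u :=
  (Σ k : ℕ, {f : (i : Fin k) → X i.1 // f ∈ Y k}) ⊕
    {g : (n : ℕ) → X n // ∀ k : ℕ, (fun i : Fin k => g i.1) ∈ Y k}

/-- The cylinder set `Z(A)` over `A` at level `k`: all sequences of length `≥ k`
whose initial segment of length `k` lies in `A`. -/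
def Zcyl (Y : (k : ℕ) → Set ((i : Fin k) → X i.1)) (k : ℕ)
    (A : Set ((i : Fin k) → X i.1)) : Set (PathSpace Y) :=
  Sum.elim (fun q => ∃ h : k ≤ q.1, restrictSeq h q.2.1 ∈ A)
    (fun g => (fun i : Fin k => g.1 i.1) ∈ A)

/-- The cylinder topology `τ_cyl`, generated by the open cylinder sets. -/
def tauCyl [∀ n, TopologicalSpace (X n)] (Y : (k : ℕ) → Set ((i : Fin k) → X i.1)) :
    TopologicalSpace (PathSpace Y) :=
  TopologicalSpace.generateFrom
    {S | ∃ (k : ℕ) (U : Set ((i : Fin k) → X i.1)), IsOpen U ∧ S = Zcyl Y k U}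

/-- The length of a finite or infinite sequence. -/
def plen (Y : (k : ℕ) → Set ((i : Fin k) → X i.1)) (p : PathSpace Y) : ℕ∞ :=
  Sum.elim (fun q => (q.1 : ℕ∞)) (fun _ => (⊤ : ℕ∞)) p

/-- Truncation of an element of the path space to length `k ≤ plen p`. -/
def truncSeq (Y : (k : ℕ) → Set ((i : Fin k) → X i.1)) (k : ℕ) :
    (p : PathSpace Y) → ((k : ℕ∞) ≤ plen Y p) → ((i : Fin k) → X i.1)
  | Sum.inl q, h => restrictSeq (by simpa [plen] using h) q.2.1
  | Sum.inr g, _ => fun i => g.1 i.1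

/-- A set is saturated if it is the intersection of its open neighbourhoods. -/
def SaturatedSet {Z : Type*} [TopologicalSpace Z] (A : Set Z) : Prop :=
  A = ⋂₀ {U : Set Z | IsOpen U ∧ A ⊆ U}

/-- The patch topology of a topology `t`: the coarsest topology refining both `t`
and the cocompact topology (generated by complements of `t`-compact saturated sets). -/
def patchOf {Z : Type*} (t : TopologicalSpace Z) : TopologicalSpace Z :=
  t ⊓ TopologicalSpace.generateFrom
    {V | ∃ K : Set Z, @IsCompact Z t K ∧ @SaturatedSet Z t K ∧ V = Kᶜ}

section PatchBasis

variable {Y : (k : ℕ) → Set ((i : Fin k) → X i.1)}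

lemma Zcyl_mono {k : ℕ} {A B : Set ((i : Fin k) → X i.1)} (h : A ⊆ B) :
    Zcyl Y k A ⊆ Zcyl Y k B := by
  rintro (q | g) hp
  · obtain ⟨hk, hq⟩ := hp
    exact ⟨hk, h hq⟩
  · exact h hp

lemma mem_Zcyl_self {k : ℕ} {f : (i : Fin k) → X i.1} (hf : f ∈ Y k)
    {A : Set ((i : Fin k) → X i.1)} (hA : f ∈ A) :
    (Sum.inl ⟨k, f, hf⟩ : PathSpace Y) ∈ Zcyl Y k A :=
  ⟨le_rfl, hA⟩

lemma Zcyl_zero_univ : Zcyl Y 0 univ = univ := by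
  ext p
  rcases p with q | g
  · exact ⟨fun _ => trivial, fun _ => ⟨Nat.zero_le _, trivial⟩⟩
  · exact ⟨fun _ => trivial, fun _ => trivial⟩

/-- A point of a cylinder set has a truncation in `Y k` that lies in the base. -/
lemma exists_of_mem_Zcyl
    (hcompat : ∀ (k l : ℕ) (h : k ≤ l), ∀ f ∈ Y l, restrictSeq h f ∈ Y k)
    {k : ℕ} {A : Set ((i : Fin k) → X i.1)} {p : PathSpace Y} (hp : p ∈ Zcyl Y k A) :
    ∃ f ∈ A, f ∈ Y k ∧ ∀ B : Set ((i : Fin k) → X i.1), p ∈ Zcyl Y k B ↔ f ∈ B := by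
  rcases p with q | g
  · obtain ⟨hk, hq⟩ := hp
    exact ⟨_, hq, hcompat _ _ hk _ q.2.2, fun B => ⟨fun ⟨_, h⟩ => h, fun h => ⟨hk, h⟩⟩⟩
  · exact ⟨_, hp, g.2 k, fun B => Iff.rfl⟩

lemma Zcyl_inter (k l : ℕ) (A : Set ((i : Fin k) → X i.1)) (B : Set ((i : Fin l) → X i.1)) :
    Zcyl Y k A ∩ Zcyl Y l B =
      Zcyl Y (max k l)
        (restrictSeq (le_max_left k l) ⁻¹' A ∩ restrictSeq (le_max_right k l) ⁻¹' B) := by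
  ext p
  rcases p with q | g
  · constructor
    · rintro ⟨⟨hk, hA⟩, ⟨hl, hB⟩⟩
      exact ⟨max_le hk hl, hA, hB⟩
    · rintro ⟨h, hA, hB⟩
      exact ⟨⟨(le_max_left k l).trans h, hA⟩, ⟨(le_max_right k l).trans h, hB⟩⟩
  · exact Iff.rfl

variable [∀ n, TopologicalSpace (X n)]

lemma continuous_restrictSeq {k l : ℕ} (h : k ≤ l) :
    Continuous (restrictSeq (X := X) h) :=
  continuous_pi fun i => continuous_apply (⟨i.1, lt_of_lt_of_le i.2 h⟩ : Fin l)

lemma isOpen_Zcyl {k : ℕ} {U : Set ((i : Fin k) → X i.1)} (hU : IsOpen U) :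
    IsOpen[tauCyl Y] (Zcyl Y k U) :=
  isOpen_generateFrom_of_mem ⟨k, U, hU, rfl⟩

/-- Open cylinder sets form a basis of the cylinder topology. -/
lemma exists_Zcyl_subset {W : Set (PathSpace Y)} (hW : IsOpen[tauCyl Y] W)
    {p : PathSpace Y} (hp : p ∈ W) :
    ∃ (k : ℕ) (U : Set ((i : Fin k) → X i.1)), IsOpen U ∧ p ∈ Zcyl Y k U ∧ Zcyl Y k U ⊆ W := by
  induction hW with
  | basic s hs =>
    obtain ⟨k, U, hU, rfl⟩ := hs
    exact ⟨k, U, hU, hp, Subset.rfl⟩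
  | univ => exact ⟨0, univ, isOpen_univ, by simp [Zcyl_zero_univ], subset_univ _⟩
  | inter s t _ _ ihs iht =>
    obtain ⟨k, U, hU, hpU, hUs⟩ := ihs hp.1
    obtain ⟨l, V, hV, hpV, hVt⟩ := iht hp.2
    refine ⟨max k l, _, (hU.preimage (continuous_restrictSeq (le_max_left k l))).inter
      (hV.preimage (continuous_restrictSeq (le_max_right k l))), ?_⟩
    rw [← Zcyl_inter]
    exact ⟨⟨hpU, hpV⟩, inter_subset_inter hUs hVt⟩
  | sUnion S _ ih =>
    obtain ⟨s, hs, hps⟩ := hp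
    obtain ⟨k, U, hU, hpU, hUs⟩ := ih s hs hps
    exact ⟨k, U, hU, hpU, hUs.trans (subset_sUnion_of_mem hs)⟩

/-- Open sets of the cylinder topology are closed under extension of finite sequences. -/
lemma Zcyl_singleton_subset_of_mem {W : Set (PathSpace Y)} (hW : IsOpen[tauCyl Y] W)
    {k : ℕ} {f : (i : Fin k) → X i.1} (hf : f ∈ Y k)
    (hfW : (Sum.inl ⟨k, f, hf⟩ : PathSpace Y) ∈ W) : Zcyl Y k {f} ⊆ W := by
  obtain ⟨l, U, -, ⟨hlk, hfU⟩, hUW⟩ := exists_Zcyl_subset hW hfW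
  refine Subset.trans ?_ hUW
  rintro (q | g) hp
  · obtain ⟨hk, rfl⟩ := hp
    exact ⟨hlk.trans hk, hfU⟩
  · obtain rfl := hp
    exact hfU

lemma continuous_inl_tauCyl (k : ℕ) :
    @Continuous (Y k) (PathSpace Y) _ (tauCyl Y) (fun f => Sum.inl ⟨k, f⟩) := by
  refine continuous_generateFrom_iff.2 ?_
  rintro _ ⟨l, U, hU, rfl⟩
  by_cases h : l ≤ k
  · convert hU.preimage ((continuous_restrictSeq h).comp continuous_subtype_val) using 1
    ext f
    exact ⟨fun ⟨_, hf⟩ => hf, fun hf => ⟨h, hf⟩⟩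
  · convert isOpen_empty using 1
    ext f
    exact ⟨fun ⟨h', _⟩ => h h', False.elim⟩

lemma isCompact_Zcyl
    (hcompat : ∀ (k l : ℕ) (h : k ≤ l), ∀ f ∈ Y l, restrictSeq h f ∈ Y k)
    {k : ℕ} {K : Set ((i : Fin k) → X i.1)} (hK : IsCompact K) (hKY : K ⊆ Y k) :
    @IsCompact _ (tauCyl Y) (Zcyl Y k K) := by
  let _ := tauCyl Y
  have hK' : IsCompact ((↑) ⁻¹' K : Set (Y k)) := by
    rw [Subtype.isCompact_iff, Subtype.image_preimage_coe, inter_eq_right.2 hKY]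
    exact hK
  have himage := hK'.image (continuous_inl_tauCyl k)
  refine isCompact_of_finite_subcover fun {ι} W hW hcover => ?_
  obtain ⟨t, ht⟩ := himage.elim_finite_subcover W hW (by
    rintro _ ⟨f, hf, rfl⟩
    exact hcover (mem_Zcyl_self f.2 hf))
  refine ⟨t, fun p hp => ?_⟩
  obtain ⟨f, hfK, hfY, hpf⟩ := exists_of_mem_Zcyl hcompat hp
  exact Zcyl_singleton_subset_of_mem (isOpen_biUnion fun i _ => hW i) hfY
    (ht ⟨⟨f, hfY⟩, hfK, rfl⟩) ((hpf {f}).2 rfl)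

lemma saturatedSet_Zcyl [∀ n, T1Space (X n)]
    (hcompat : ∀ (k l : ℕ) (h : k ≤ l), ∀ f ∈ Y l, restrictSeq h f ∈ Y k)
    (k : ℕ) (A : Set ((i : Fin k) → X i.1)) :
    @SaturatedSet _ (tauCyl Y) (Zcyl Y k A) := by
  refine Subset.antisymm (fun p hp U hU => hU.2 hp) fun p hp => ?_
  have hpuniv : p ∈ Zcyl Y k univ := hp _ ⟨isOpen_Zcyl isOpen_univ, Zcyl_mono (subset_univ _)⟩
  obtain ⟨f, -, -, hpf⟩ := exists_of_mem_Zcyl hcompat hpuniv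
  rw [hpf]
  by_contra hfA
  exact (hpf {f}ᶜ).1 (hp _ ⟨isOpen_Zcyl isOpen_compl_singleton,
    Zcyl_mono (subset_compl_singleton_iff.2 hfA)⟩) rfl

lemma isOpen_patchOf_of_isOpen {Z : Type*} {t : TopologicalSpace Z} {s : Set Z}
    (hs : IsOpen[t] s) : IsOpen[patchOf t] s :=
  (inf_le_left : patchOf t ≤ t) s hs

lemma isClosed_patchOf {Z : Type*} {t : TopologicalSpace Z} {C : Set Z}
    (hC : @IsCompact Z t C) (hsat : @SaturatedSet Z t C) : IsClosed[patchOf t] C :=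
  (@isOpen_compl_iff _ _ (patchOf t)).1 <|
    (inf_le_right : patchOf t ≤ _) _ (isOpen_generateFrom_of_mem ⟨C, hC, hsat, rfl⟩)

/-- A compact set inside an open set `W` of the cylinder topology is covered by finitely many
cylinders over compact sets that are contained in `W`. -/
lemma exists_finite_cover_Zcyl
    (hcompat : ∀ (k l : ℕ) (h : k ≤ l), ∀ f ∈ Y l, restrictSeq h f ∈ Y k)
    (hLC : ∀ k, LocallyCompactSpace {f : (i : Fin k) → X i.1 // f ∈ Y k})
    {C W : Set (PathSpace Y)} (hC : @IsCompact _ (tauCyl Y) C) (hW : IsOpen[tauCyl Y] W)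
    (hCW : C ⊆ W) :
    ∃ (ι : Type u) (_ : Finite ι) (l : ι → ℕ) (K : (i : ι) → Set ((j : Fin (l i)) → X j.1)),
      (∀ i, IsCompact (K i) ∧ K i ⊆ Y (l i)) ∧
        C ⊆ (⋃ i, Zcyl Y (l i) (K i)) ∧ (⋃ i, Zcyl Y (l i) (K i)) ⊆ W := by
  let _ := tauCyl Y
  have key : ∀ c : C, ∃ (k : ℕ) (K : Set ((i : Fin k) → X i.1)), IsCompact K ∧ K ⊆ Y k ∧
      Zcyl Y k K ∈ 𝓝 c.1 ∧ Zcyl Y k K ⊆ W := by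
    intro c
    obtain ⟨k, U, hU, hcU, hUW⟩ := exists_Zcyl_subset hW (hCW c.2)
    obtain ⟨f, hfU, hfY, hcf⟩ := exists_of_mem_Zcyl hcompat hcU
    obtain ⟨K, hKf, hKU, hK⟩ := (hLC k).local_compact_nhds ⟨f, hfY⟩ _
      ((hU.preimage continuous_subtype_val).mem_nhds hfU)
    obtain ⟨O, hO, hOK⟩ := isOpen_induced_iff.1 (isOpen_interior (s := K))
    refine ⟨k, (↑) '' K, hK.image continuous_subtype_val, ?_, ?_,
      (Zcyl_mono (image_subset_iff.2 hKU)).trans hUW⟩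
    · rintro _ ⟨g, -, rfl⟩
      exact g.2
    · have hfO : f ∈ O := by
        have := mem_interior_iff_mem_nhds.2 hKf
        rwa [← hOK] at this
      refine mem_of_superset ((isOpen_Zcyl hO).mem_nhds ((hcf O).2 hfO)) fun p hp => ?_
      obtain ⟨g, hgO, hgY, hpg⟩ := exists_of_mem_Zcyl hcompat hp
      refine (hpg _).2 ⟨⟨g, hgY⟩, interior_subset ?_, rfl⟩
      rw [← hOK]
      exact hgO
  choose k K hK hKY hKc hKW using key
  obtain ⟨t, ht⟩ := hC.elim_nhds_subcover' (fun c hc => Zcyl Y (k ⟨c, hc⟩) (K ⟨c, hc⟩))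
    (fun c hc => hKc ⟨c, hc⟩)
  refine ⟨t, inferInstance, fun i => k i, fun i => K i, fun i => ⟨hK i, hKY i⟩, ?_,
    iUnion_subset fun i => hKW i⟩
  intro c hc
  obtain ⟨i, hi, hci⟩ := mem_iUnion₂.1 (ht hc)
  exact mem_iUnion.2 ⟨⟨i, hi⟩, hci⟩

/-- The sets `Z(U) ∩ Z(K)ᶜ`, with `U` open and `K` a finite union of compact sets. -/
def patchBasis (Y : (k : ℕ) → Set ((i : Fin k) → X i.1)) : Set (Set (PathSpace Y)) :=
  {S | ∃ (k : ℕ) (U : Set ((i : Fin k) → X i.1)), IsOpen U ∧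
    ∃ (n : ℕ) (l : Fin n → ℕ) (K : (i : Fin n) → Set ((j : Fin (l i)) → X j.1)),
      (∀ i, IsCompact (K i) ∧ K i ⊆ Y (l i)) ∧
      S = Zcyl Y k U ∩ (⋃ i, Zcyl Y (l i) (K i))ᶜ}

lemma mem_patchBasis_of_finite {ι : Type*} [Finite ι] {k : ℕ} {U : Set ((i : Fin k) → X i.1)}
    (hU : IsOpen U) (l : ι → ℕ) (K : (i : ι) → Set ((j : Fin (l i)) → X j.1))
    (hK : ∀ i, IsCompact (K i) ∧ K i ⊆ Y (l i)) :
    Zcyl Y k U ∩ (⋃ i, Zcyl Y (l i) (K i))ᶜ ∈ patchBasis Y := by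
  obtain ⟨n, ⟨e⟩⟩ := Finite.exists_equiv_fin ι
  refine ⟨k, U, hU, n, fun i => l (e.symm i), fun i => K (e.symm i), fun i => hK _, ?_⟩
  rw [e.symm.surjective.iUnion_comp fun i => Zcyl Y (l i) (K i)]

lemma Zcyl_mem_patchBasis {k : ℕ} {U : Set ((i : Fin k) → X i.1)} (hU : IsOpen U) :
    Zcyl Y k U ∈ patchBasis Y := by
  simpa using mem_patchBasis_of_finite (ι := Empty) (Y := Y) hU (fun _ => 0) (fun _ => ∅)
    (fun i => i.elim)

lemma inter_mem_patchBasis {S T : Set (PathSpace Y)} (hS : S ∈ patchBasis Y)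
    (hT : T ∈ patchBasis Y) : S ∩ T ∈ patchBasis Y := by
  obtain ⟨k, U, hU, n, l, K, hK, rfl⟩ := hS
  obtain ⟨k', V, hV, n', l', K', hK', rfl⟩ := hT
  have h := mem_patchBasis_of_finite (Y := Y) (ι := Fin n ⊕ Fin n')
    ((hU.preimage (continuous_restrictSeq (le_max_left k k'))).inter
      (hV.preimage (continuous_restrictSeq (le_max_right k k'))))
    (Sum.elim l l') (Sum.rec K K') (Sum.rec hK hK')
  rw [← Zcyl_inter, iUnion_sum, compl_union] at h
  rw [inter_inter_inter_comm]
  exact h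

lemma isOpen_of_mem_patchBasis [∀ n, T1Space (X n)]
    (hcompat : ∀ (k l : ℕ) (h : k ≤ l), ∀ f ∈ Y l, restrictSeq h f ∈ Y k)
    {S : Set (PathSpace Y)} (hS : S ∈ patchBasis Y) : IsOpen[patchOf (tauCyl Y)] S := by
  obtain ⟨k, U, hU, n, l, K, hK, rfl⟩ := hS
  let _ := patchOf (tauCyl Y)
  exact IsOpen.inter (isOpen_patchOf_of_isOpen (isOpen_Zcyl hU))
    (isClosed_iUnion_of_finite fun i => isClosed_patchOf
      (isCompact_Zcyl hcompat (hK i).1 (hK i).2) (saturatedSet_Zcyl hcompat _ _)).isOpen_compl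

lemma exists_mem_patchBasis_subset
    (hcompat : ∀ (k l : ℕ) (h : k ≤ l), ∀ f ∈ Y l, restrictSeq h f ∈ Y k)
    (hLC : ∀ k, LocallyCompactSpace {f : (i : Fin k) → X i.1 // f ∈ Y k})
    {W : Set (PathSpace Y)} (hW : IsOpen[patchOf (tauCyl Y)] W) {p : PathSpace Y} (hp : p ∈ W) :
    ∃ S ∈ patchBasis Y, p ∈ S ∧ S ⊆ W := by
  rw [patchOf, tauCyl, ← generateFrom_union] at hW
  induction hW with
  | basic s hs =>
    rcases hs with ⟨k, U, hU, rfl⟩ | ⟨C, hC, hsat, rfl⟩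
    · exact ⟨_, Zcyl_mem_patchBasis hU, hp, Subset.rfl⟩
    · rw [hsat] at hp
      simp only [mem_compl_iff, mem_sInter, not_forall] at hp
      obtain ⟨V, ⟨hV, hCV⟩, hpV⟩ := hp
      obtain ⟨ι, _, l, K, hK, hCK, hKV⟩ := exists_finite_cover_Zcyl hcompat hLC hC hV hCV
      refine ⟨_, mem_patchBasis_of_finite (k := 0) isOpen_univ l K hK, ?_,
        inter_subset_right.trans (compl_subset_compl.2 hCK)⟩
      rw [Zcyl_zero_univ]
      exact ⟨trivial, fun h => hpV (hKV h)⟩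
  | univ => exact ⟨_, Zcyl_mem_patchBasis (k := 0) isOpen_univ, by simp [Zcyl_zero_univ],
      subset_univ _⟩
  | inter s t _ _ ihs iht =>
    obtain ⟨S, hS, hpS, hSs⟩ := ihs hp.1
    obtain ⟨T, hT, hpT, hTt⟩ := iht hp.2
    exact ⟨S ∩ T, inter_mem_patchBasis hS hT, ⟨hpS, hpT⟩, inter_subset_inter hSs hTt⟩
  | sUnion 𝒮 _ ih =>
    obtain ⟨s, hs, hps⟩ := hp
    obtain ⟨S, hS, hpS, hSs⟩ := ih s hs hps
    exact ⟨S, hS, hpS, hSs.trans (subset_sUnion_of_mem hs)⟩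

end PatchBasis

/-- the sets `Z(U) ∩ Z(K)ᶜ`, for `U` open at some level `k` and `K`
a finite union of compact sets `K i ⊆ Y (l i)`, form a basis for the patch
topology of `(Y, τ_cyl)`. -/
theorem stmt_10 [∀ n, TopologicalSpace (X n)] [∀ n, T1Space (X n)] [∀ n, QuasiSober (X n)]
    [∀ n, LocallyCompactSpace (X n)]
    (Y : (k : ℕ) → Set ((i : Fin k) → X i.1))
    (hclosed : ∀ k, IsClosed (Y k))
    (hcompat : ∀ (k l : ℕ) (h : k ≤ l), ∀ f ∈ Y l, restrictSeq h f ∈ Y k)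
    (hLC : ∀ k, LocallyCompactSpace {f : (i : Fin k) → X i.1 // f ∈ Y k}) :
    @IsTopologicalBasis (PathSpace Y) (patchOf (tauCyl Y))
      {S | ∃ (k : ℕ) (U : Set ((i : Fin k) → X i.1)), IsOpen U ∧
        ∃ (n : ℕ) (l : Fin n → ℕ) (K : (i : Fin n) → Set ((j : Fin (l i)) → X j.1)),
          (∀ i, IsCompact (K i) ∧ K i ⊆ Y (l i)) ∧
          S = Zcyl Y k U ∩ (⋃ i, Zcyl Y (l i) (K i))ᶜ} := by
  let _ := patchOf (tauCyl Y)
  exact isTopologicalBasis_of_isOpen_of_nhds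
    (fun _ hS => isOpen_of_mem_patchBasis hcompat hS)
    (fun _ _ hp hW => exists_mem_patchBasis_subset hcompat hLC hW hp)
end

section
/- Let E be a directed graph. The intersection of two basic sets [Z({μ}) ∩ (⋃_{e∈F} Z({μe}))ᶜ] ∩ [Z({ν}) ∩ (⋃_{f∈G} Z({νf}))ᶜ] equals: Z({μ}) ∩ (⋃_{e∈F} Z({μe}))ᶜ if |μ| > |ν|, ν is a prefix of μ, and μ_{|ν|+1} ∉ G; symmetrically with μ, ν swapped if |ν| > |μ|; Z({μ}) ∩ (⋃_{e∈F∪G} Z({μe}))ᶜ if μ = ν; and ∅ otherwise. -/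
/-- A finite path in a directed graph with vertex set `V`, edge set `E`, domain
map `d` and range map `r`: a chained list of edges `μ₁…μₙ` (with
`d μᵢ = r μ_{i+1}`) together with its terminal vertex `vert = d μ`; a vertex is
the path with no edges. -/
structure FinPath (V E : Type*) (d r : E → V) where
  vert : V
  edges : List E
  chain : edges.Chain' (fun a b => d a = r b)
  compat : ∀ h : edges ≠ [], d (edges.getLast h) = vert

/-- An infinite path: a chained infinite sequence of edges. -/
structure InfPath (V E : Type*) (d r : E → V) where
  seq : ℕ → E
  chain : ∀ i : ℕ, d (seq i) = r (seq (i + 1))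

/-- The space of all finite and infinite paths of a directed graph. -/
def GPath (V E : Type*) (d r : E → V) : Type _ :=
  FinPath V E d r ⊕ InfPath V E d r

/-- `HasRawPrefix d r p es v` says that the path `p` has the finite path with edge
list `es` and terminal vertex `v` as a prefix. -/
def HasRawPrefix {V E : Type*} (d r : E → V) (p : GPath V E d r)
    (es : List E) (v : V) : Prop :=
  Sum.elim
    (fun ξ : FinPath V E d r =>
      es <+: ξ.edges ∧
      (∀ h : es.length < ξ.edges.length, v = r (ξ.edges.get ⟨es.length, h⟩)) ∧
      (es.length = ξ.edges.length → v = ξ.vert))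
    (fun g : InfPath V E d r =>
      (∀ (i : ℕ) (h : i < es.length), es.get ⟨i, h⟩ = g.seq i) ∧ v = r (g.seq es.length))
    p

/-- The cylinder set `Z({μ})` of all paths with prefix `μ`. -/
def ZP {V E : Type*} (d r : E → V) (μ : FinPath V E d r) : Set (GPath V E d r) :=
  {p | HasRawPrefix d r p μ.edges μ.vert}

/-- The cylinder set `Z({μe})` of all paths with prefix the extension of `μ` by
the edge `e`. -/
def ZPe {V E : Type*} (d r : E → V) (μ : FinPath V E d r) (e : E) :
    Set (GPath V E d r) :=
  {p | HasRawPrefix d r p (μ.edges ++ [e]) (d e)}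

/-- The basic set `Z({μ}) ∩ (⋃_{e ∈ F} Z({μe}))ᶜ`. -/
def ZB {V E : Type*} (d r : E → V) (μ : FinPath V E d r) (F : Set E) :
    Set (GPath V E d r) :=
  ZP d r μ ∩ (⋃ e ∈ F, ZPe d r μ e)ᶜ

namespace GPath

variable {V E : Type*} {d r : E → V}

/-- The edge of a path at position `n`, if there is one. -/
def edge? (p : GPath V E d r) (n : ℕ) : Option E :=
  Sum.elim (fun ξ : FinPath V E d r => ξ.edges[n]?) (fun g : InfPath V E d r => some (g.seq n)) p

/-- The vertex of a path at position `n`; past the end of a finite path it is the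
terminal vertex. -/
def vertexAt (p : GPath V E d r) (n : ℕ) : V :=
  Sum.elim (fun ξ : FinPath V E d r => (ξ.edges[n]?).elim ξ.vert r)
    (fun g : InfPath V E d r => r (g.seq n)) p

theorem vertexAt_of_edge? {p : GPath V E d r} {n : ℕ} {e : E} (h : p.edge? n = some e) :
    p.vertexAt n = r e := by
  rcases p with ξ | g
  · replace h : ξ.edges[n]? = some e := h
    simp [vertexAt, h]
  · replace h : some (g.seq n) = some e := h
    simpa [vertexAt] using congrArg r (Option.some.inj h)

theorem vertexAt_succ_of_edge? {p : GPath V E d r} {n : ℕ} {e : E} (h : p.edge? n = some e) :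
    p.vertexAt (n + 1) = d e := by
  rcases p with ξ | g
  · replace h : ξ.edges[n]? = some e := h
    obtain ⟨hn, rfl⟩ := List.getElem?_eq_some_iff.1 h
    change (ξ.edges[n + 1]?).elim ξ.vert r = d ξ.edges[n]
    by_cases hn' : n + 1 < ξ.edges.length
    · simpa [hn'] using (List.isChain_iff_getElem.1 ξ.chain n hn').symm
    · have hne : ξ.edges ≠ [] := List.ne_nil_of_length_pos (by omega)
      have hlast : n = ξ.edges.length - 1 := by omega
      have := ξ.compat hne
      rw [List.getLast_eq_getElem] at this
      subst hlast
      rw [List.getElem?_eq_none (by omega)]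
      exact this.symm
  · replace h : some (g.seq n) = some e := h
    cases h
    exact (g.chain n).symm

theorem hasRawPrefix_iff {p : GPath V E d r} {es : List E} {v : V} :
    HasRawPrefix d r p es v ↔
      (∀ i < es.length, p.edge? i = es[i]?) ∧ v = p.vertexAt es.length := by
  rcases p with ξ | g
  · change (es <+: ξ.edges ∧
      (∀ h : es.length < ξ.edges.length, v = r (ξ.edges.get ⟨es.length, h⟩)) ∧
      (es.length = ξ.edges.length → v = ξ.vert)) ↔
      (∀ i < es.length, ξ.edges[i]? = es[i]?) ∧ v = (ξ.edges[es.length]?).elim ξ.vert r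
    have hprefix : es <+: ξ.edges ↔ ∀ i < es.length, ξ.edges[i]? = es[i]? := by
      rw [List.prefix_iff_getElem?]
      exact forall₂_congr fun i hi => by simp [hi]
    rw [← hprefix]
    refine and_congr_right fun h => ?_
    rcases h.length_le.lt_or_eq with hlt | heq
    · simp [hlt, hlt.ne]
    · simp [heq]
  · change ((∀ (i : ℕ) (h : i < es.length), es.get ⟨i, h⟩ = g.seq i) ∧ v = r (g.seq es.length)) ↔
      (∀ i < es.length, some (g.seq i) = es[i]?) ∧ v = r (g.seq es.length)
    refine and_congr_left' (forall₂_congr fun i hi => ?_)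
    simp [hi, eq_comm]

theorem mem_ZP_iff {p : GPath V E d r} {μ : FinPath V E d r} :
    p ∈ ZP d r μ ↔
      (∀ i < μ.edges.length, p.edge? i = μ.edges[i]?) ∧ μ.vert = p.vertexAt μ.edges.length :=
  hasRawPrefix_iff

theorem mem_ZPe_iff {p : GPath V E d r} {μ : FinPath V E d r} {e : E} (hp : p ∈ ZP d r μ) :
    p ∈ ZPe d r μ e ↔ p.edge? μ.edges.length = some e := by
  rw [mem_ZP_iff] at hp
  change HasRawPrefix d r p (μ.edges ++ [e]) (d e) ↔ _
  rw [hasRawPrefix_iff]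
  refine ⟨fun h => ?_, fun h => ⟨fun i hi => ?_, ?_⟩⟩
  · simpa using h.1 μ.edges.length (by simp)
  · rcases Nat.lt_or_ge i μ.edges.length with hlt | hge
    · rw [hp.1 i hlt, List.getElem?_append_left hlt]
    · obtain rfl : i = μ.edges.length := by
        simp only [List.length_append, List.length_singleton] at hi
        omega
      simpa using h
  · simpa using (vertexAt_succ_of_edge? h).symm

theorem mem_ZB_iff {p : GPath V E d r} {μ : FinPath V E d r} {F : Set E} :
    p ∈ ZB d r μ F ↔ p ∈ ZP d r μ ∧ ∀ e ∈ F, p.edge? μ.edges.length ≠ some e := by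
  refine and_congr_right fun hp => ?_
  simp only [Set.mem_compl_iff, Set.mem_iUnion, not_exists]
  exact forall₂_congr fun e _ => not_congr (mem_ZPe_iff hp)

theorem edge?_eq_get {p : GPath V E d r} {μ : FinPath V E d r} (hp : p ∈ ZP d r μ) {n : ℕ}
    (h : n < μ.edges.length) : p.edge? n = some (μ.edges.get ⟨n, h⟩) := by
  rw [(mem_ZP_iff.1 hp).1 n h]
  simp [h]

theorem inl_mem_ZP_self (μ : FinPath V E d r) : (Sum.inl μ : GPath V E d r) ∈ ZP d r μ :=
  mem_ZP_iff.2 ⟨fun _ _ => rfl, by simp [vertexAt]⟩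

/-- Two paths with the common prefix `μ` have the same prefixes shorter than `μ`. -/
theorem mem_ZP_congr {p q : GPath V E d r} {μ ν : FinPath V E d r} (hp : p ∈ ZP d r μ)
    (hq : q ∈ ZP d r μ) (hlt : ν.edges.length < μ.edges.length) :
    p ∈ ZP d r ν ↔ q ∈ ZP d r ν := by
  rw [mem_ZP_iff, mem_ZP_iff, vertexAt_of_edge? (edge?_eq_get hp hlt),
    vertexAt_of_edge? (edge?_eq_get hq hlt)]
  refine and_congr_left' (forall₂_congr fun i hi => ?_)
  rw [edge?_eq_get hp (hi.trans hlt), edge?_eq_get hq (hi.trans hlt)]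

theorem eq_of_mem_ZP {p : GPath V E d r} {μ ν : FinPath V E d r} (hμ : p ∈ ZP d r μ)
    (hν : p ∈ ZP d r ν) (hlen : μ.edges.length = ν.edges.length) : μ = ν := by
  rw [mem_ZP_iff] at hμ hν
  have hvert : μ.vert = ν.vert := by rw [hμ.2, hν.2, hlen]
  have hedges : μ.edges = ν.edges := by
    refine List.ext_getElem hlen fun i h₁ h₂ => ?_
    simpa [h₁, h₂] using (hμ.1 i h₁).symm.trans (hν.1 i h₂)
  cases μ
  cases ν
  simp_all

/-- A point of `Z({μ})` lies in the basic set of a shorter path `ν` exactly when `ν` is a prefix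
of `μ` and the next edge of `μ` is not removed. -/
theorem mem_ZB_iff_of_mem_ZP {p : GPath V E d r} {μ ν : FinPath V E d r} {G : Set E}
    (hp : p ∈ ZP d r μ) (hlt : ν.edges.length < μ.edges.length) :
    p ∈ ZB d r ν G ↔ ν.edges.length < μ.edges.length ∧
      HasRawPrefix d r (Sum.inl μ) ν.edges ν.vert ∧
      ∀ h : ν.edges.length < μ.edges.length, μ.edges.get ⟨ν.edges.length, h⟩ ∉ G := by
  have hprefix := mem_ZP_congr hp (inl_mem_ZP_self μ) hlt
  rw [mem_ZB_iff, edge?_eq_get hp hlt]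
  refine ⟨fun h => ⟨hlt, hprefix.1 h.1, fun _ hG => h.2 _ hG rfl⟩,
    fun h => ⟨hprefix.2 h.2.1, fun e he heq => ?_⟩⟩
  exact h.2.2 hlt (Option.some.inj heq ▸ he)

end GPath

/-- the intersection of two basic sets
`[Z({μ}) ∩ (⋃_{e∈F} Z({μe}))ᶜ] ∩ [Z({ν}) ∩ (⋃_{f∈G} Z({νf}))ᶜ]` equals the first
set if `|μ| > |ν|`, `ν` is a prefix of `μ` and `μ_{|ν|+1} ∉ G`; symmetrically the
second set with `μ, ν` swapped; `Z({μ}) ∩ (⋃_{e∈F∪G} Z({μe}))ᶜ` if `μ = ν`; and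
`∅` otherwise. -/
theorem stmt_14 {V E : Type*} (d r : E → V) (μ ν : FinPath V E d r)
    (F G : Set E) (hF : F.Finite) (hG : G.Finite)
    (hFr : ∀ e ∈ F, r e = μ.vert) (hGr : ∀ e ∈ G, r e = ν.vert) :
    ((ν.edges.length < μ.edges.length ∧
        HasRawPrefix d r (Sum.inl μ) ν.edges ν.vert ∧
        ∀ h : ν.edges.length < μ.edges.length,
          μ.edges.get ⟨ν.edges.length, h⟩ ∉ G) →
      ZB d r μ F ∩ ZB d r ν G = ZB d r μ F) ∧
    ((μ.edges.length < ν.edges.length ∧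
        HasRawPrefix d r (Sum.inl ν) μ.edges μ.vert ∧
        ∀ h : μ.edges.length < ν.edges.length,
          ν.edges.get ⟨μ.edges.length, h⟩ ∉ F) →
      ZB d r μ F ∩ ZB d r ν G = ZB d r ν G) ∧
    (μ = ν → ZB d r μ F ∩ ZB d r ν G = ZB d r μ (F ∪ G)) ∧
    (¬ (ν.edges.length < μ.edges.length ∧
        HasRawPrefix d r (Sum.inl μ) ν.edges ν.vert ∧
        ∀ h : ν.edges.length < μ.edges.length,
          μ.edges.get ⟨ν.edges.length, h⟩ ∉ G) →
      ¬ (μ.edges.length < ν.edges.length ∧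
        HasRawPrefix d r (Sum.inl ν) μ.edges μ.vert ∧
        ∀ h : μ.edges.length < ν.edges.length,
          ν.edges.get ⟨μ.edges.length, h⟩ ∉ F) →
      μ ≠ ν →
      ZB d r μ F ∩ ZB d r ν G = ∅) := by
  refine ⟨fun h => ?_, fun h => ?_, ?_, fun hμ hν hne => ?_⟩
  · exact Set.inter_eq_left.2 fun p hp => (GPath.mem_ZB_iff_of_mem_ZP hp.1 h.1).2 h
  · exact Set.inter_eq_right.2 fun p hp => (GPath.mem_ZB_iff_of_mem_ZP hp.1 h.1).2 h
  · rintro rfl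
    simp only [ZB, Set.biUnion_union, Set.compl_union]
    exact Set.inter_inter_distrib_left _ _ _ |>.symm
  · refine Set.eq_empty_of_forall_notMem fun p hp => ?_
    rcases lt_trichotomy ν.edges.length μ.edges.length with hlt | heq | hlt
    · exact hμ ((GPath.mem_ZB_iff_of_mem_ZP hp.1.1 hlt).1 hp.2)
    · exact hne (GPath.eq_of_mem_ZP hp.1.1 hp.2.1 heq.symm)
    · exact hν ((GPath.mem_ZB_iff_of_mem_ZP hp.2.1 hlt).1 hp.1)
end
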